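/- For every real number a with 0 ≤ a < 27/4, the function s ↦ 1/(a·s + 1/(1+s)²) is interval-integrable on (-1, 0); in particular the quantity t̄(a) = ∫_{-1}^{0} ds/(a·s + 1/(1+s)²) is a well-defined finite positive real number. -/

import Mathlib

/-- The cubic `a s (1+s)² + 1` is positive on `[-1, ∞)` when `0 ≤ a < 27/4`. -/
lemma cubic_pos {a s : ℝ} (ha0 : 0 ≤ a) (ha1 : a < 27 / 4) (hs : -1 ≤ s) :
    0 < a * s * (1 + s) ^ 2 + 1 := by
  have h : 0 ≤ a * ((s + 1 / 3) ^ 2 * (s + 4 / 3)) :=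
    mul_nonneg ha0 (mul_nonneg (sq_nonneg _) (by linarith))
  linear_combination h + 4 / 27 * ha1

lemma one_div_add_one_div_sq (a : ℝ) {s : ℝ} (hs : -1 < s) :
    1 / (a * s + 1 / (1 + s) ^ 2) = (1 + s) ^ 2 / (a * s * (1 + s) ^ 2 + 1) := by
  have h : 1 + s ≠ 0 := by linarith
  rw [add_div' _ _ _ (pow_ne_zero 2 h), one_div_div]

/-- For `0 ≤ a < 27/4`, the integrand `s ↦ 1/(as + 1/(1+s)²)` is interval
integrable on `(-1,0)` and the touchdown-time bound
`t̄(a) = ∫₋₁⁰ ds/(as + 1/(1+s)²)` is a finite positive real number. -/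
theorem tbar_integrable_pos (a : ℝ) (ha0 : 0 ≤ a) (ha1 : a < 27 / 4) :
    IntervalIntegrable (fun s : ℝ => 1 / (a * s + 1 / (1 + s) ^ 2))
        MeasureTheory.volume (-1) 0 ∧
    0 < ∫ s in (-1 : ℝ)..0, 1 / (a * s + 1 / (1 + s) ^ 2) := by
  have hcont : ContinuousOn (fun s : ℝ => (1 + s) ^ 2 / (a * s * (1 + s) ^ 2 + 1))
      (Set.uIcc (-1) 0) := by
    refine ContinuousOn.div (by fun_prop) (by fun_prop) fun s hs => ?_
    rw [Set.uIcc_of_le (by norm_num)] at hs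
    exact (cubic_pos ha0 ha1 hs.1).ne'
  have hint : IntervalIntegrable (fun s : ℝ => 1 / (a * s + 1 / (1 + s) ^ 2))
      MeasureTheory.volume (-1) 0 := by
    refine hcont.intervalIntegrable.congr fun s hs => ?_
    rw [Set.uIoc_of_le (by norm_num)] at hs
    exact (one_div_add_one_div_sq a hs.1).symm
  refine ⟨hint, intervalIntegral.intervalIntegral_pos_of_pos_on hint (fun s hs => ?_)
    (by norm_num)⟩
  rw [one_div_add_one_div_sq a hs.1]
  have h : 0 < 1 + s := by linarith [hs.1]
  exact div_pos (pow_pos h 2) (cubic_pos ha0 ha1 hs.1.le)
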